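/- Let Ω ⊆ ℂ∖(-∞,0] be a simply connected domain, convex in the positive direction and not contained in any horizontal half-plane, let h be a Koenigs map onto Ω, and fix p ≥ 1 and α > -1. If θ_Ω = θ_Ω⁻ + θ_Ω⁺ ∈ (π, 2π], then for every λ ∈ ℂ one has e^{λh} ∈ A_α^p if and only if λ = 0; that is, σ_{p,α} = {0}. (Theorem 1.6(d) for the Bergman space.) -/

import Mathlib

open MeasureTheory Set Complex Metric
open scoped ENNReal NNReal

noncomputable section

/-- `h` is a Koenigs map onto `Ω`: an injective holomorphic map on the unit disk with image `Ω`. -/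
def IsKoenigsMap (h : ℂ → ℂ) (Ω : Set ℂ) : Prop :=
  DifferentiableOn ℂ h (ball 0 1) ∧ InjOn h (ball 0 1) ∧ h '' ball 0 1 = Ω

/-- `Ω` is convex in the positive direction: `Ω + t ⊆ Ω` for all `t ≥ 0`. -/
def ConvexPosDir (Ω : Set ℂ) : Prop :=
  ∀ t : ℝ, 0 ≤ t → ∀ w ∈ Ω, w + (t : ℂ) ∈ Ω

/-- Membership in the weighted Bergman space `A_α^p`:
`∫_𝔻 |f(z)|^p (1-|z|²)^α dA(z) < ∞`. -/
def MemBergman (p α : ℝ) (f : ℂ → ℂ) : Prop :=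
  ∫⁻ z in ball (0 : ℂ) 1,
    (‖f z‖₊ : ℝ≥0∞) ^ p * ENNReal.ofReal ((1 - ‖z‖ ^ 2) ^ α) < ⊤

/-- The open angular sector `S(α,β) = {w ≠ 0 : α < arg w < β}` (principal argument). -/
def sector (a b : ℝ) : Set ℂ :=
  {w : ℂ | w ≠ 0 ∧ a < Complex.arg w ∧ Complex.arg w < b}

/-- The lower inner argument `θ_Ω⁻`, for a domain in the slit plane. -/
def lowerInnerArg (Ω : Set ℂ) : ℝ :=
  sSup ({0} ∪ {θ : ℝ | θ ∈ Ioc 0 Real.pi ∧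
    ∃ q : ℂ, (fun w => q + w) '' sector (-θ) 0 ⊆ Ω ∩ sector (-Real.pi) 0})

/-- The lower outer argument `Θ_Ω⁻`, for a domain in the slit plane. -/
def lowerOuterArg (Ω : Set ℂ) : ℝ :=
  sInf {θ : ℝ | θ ∈ Ioc 0 Real.pi ∧
    ∃ q : ℂ, Ω ∩ sector (-Real.pi) 0 ⊆ (fun w => q + w) '' sector (-θ) 0}

/-- The upper inner argument `θ_Ω⁺`, for a domain in the slit plane. -/
def upperInnerArg (Ω : Set ℂ) : ℝ :=
  sSup ({0} ∪ {θ : ℝ | θ ∈ Ioc 0 Real.pi ∧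
    ∃ q : ℂ, (fun w => q + w) '' sector 0 θ ⊆ Ω ∩ sector 0 Real.pi})

/-- The upper outer argument `Θ_Ω⁺`, for a domain in the slit plane. -/
def upperOuterArg (Ω : Set ℂ) : ℝ :=
  sInf {θ : ℝ | θ ∈ Ioc 0 Real.pi ∧
    ∃ q : ℂ, Ω ∩ sector 0 Real.pi ⊆ (fun w => q + w) '' sector 0 θ}

/-- The weight `(1 - |z|²)^α` is integrable on the unit disk when `α > -1`. -/
lemma lintegral_one_sub_normSq_rpow_lt_top {α : ℝ} (hα : -1 < α) :
    ∫⁻ z in ball (0 : ℂ) 1, ENNReal.ofReal ((1 - ‖z‖ ^ 2) ^ α) < ⊤ := by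
  have key : IntegrableOn (fun z : ℂ => (1 - ‖z‖ ^ 2) ^ α) (ball 0 1) volume := by
    rw [integrableOn_fun_norm_addHaar volume (f := fun y : ℝ => (1 - y ^ 2) ^ α)]
    have h1 : IntervalIntegrable (fun y : ℝ => y ^ α) volume 0 1 :=
      intervalIntegral.intervalIntegrable_rpow' hα
    have h2 := h1.comp_sub_left 1
    simp only [sub_zero, sub_self] at h2
    have h3 : IntegrableOn (fun y : ℝ => (1 - y) ^ α) (Ioo 0 1) volume :=
      (intervalIntegrable_iff_integrableOn_Ioo_of_le zero_le_one).1 h2.symm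
    have h4 : IntegrableOn (fun y : ℝ => 2 ^ |α| * (1 - y) ^ α) (Ioo 0 1) volume :=
      h3.const_mul _
    refine Integrable.mono' h4 (by fun_prop) ?_
    refine (ae_restrict_iff' measurableSet_Ioo).2 (ae_of_all _ fun y hy => ?_)
    obtain ⟨hy0, hy1⟩ := hy
    have e : 1 - y ^ 2 = (1 - y) * (1 + y) := by ring
    have hpos : 0 < 1 - y := by linarith
    have hpos' : 0 < 1 + y := by linarith
    have hb : (1 + y) ^ α ≤ 2 ^ |α| :=
      (Real.rpow_le_rpow_of_exponent_le (by linarith) (le_abs_self α)).trans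
        (Real.rpow_le_rpow (by linarith) (by linarith) (abs_nonneg α))
    have hnn : 0 ≤ (1 - y ^ 2) ^ α := Real.rpow_nonneg (by nlinarith) _
    simp only [Complex.finrank_real_complex, smul_eq_mul, norm_mul, Real.norm_eq_abs,
      abs_of_nonneg hnn]
    rw [e, Real.mul_rpow hpos.le hpos'.le]
    have : |y ^ (2 - 1)| ≤ 1 := by simp [abs_of_pos hy0, hy1.le]
    have hq : 0 ≤ (1 - y) ^ α := Real.rpow_nonneg hpos.le _
    have hq' : 0 ≤ (1 + y) ^ α := Real.rpow_nonneg hpos'.le _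
    calc |y ^ (2 - 1)| * ((1 - y) ^ α * (1 + y) ^ α)
        ≤ 1 * ((1 - y) ^ α * (1 + y) ^ α) := by gcongr
      _ = (1 + y) ^ α * (1 - y) ^ α := by ring
      _ ≤ 2 ^ |α| * (1 - y) ^ α := by gcongr
  exact key.lintegral_lt_top

/-- A holomorphic function is bounded at the centre of a circle by its mean on that circle. -/
lemma two_pi_mul_enorm_le_lintegral_circle {F : ℂ → ℂ} {z : ℂ} {ρ : ℝ} (hρ : 0 ≤ ρ)
    (hF : DifferentiableOn ℂ F (closedBall z ρ)) :
    ENNReal.ofReal (2 * Real.pi) * ‖F z‖ₑ ≤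
      ∫⁻ θ in Ioo (-Real.pi) Real.pi, ‖F (circleMap z ρ θ)‖ₑ := by
  have hmean : Real.circleAverage F z ρ = F z := by
    apply DiffContOnCl.circleAverage
    rw [abs_of_nonneg hρ]
    exact hF.diffContOnCl_ball subset_rfl
  have hint : ((2 * Real.pi : ℝ) : ℂ) * F z =
      ∫ θ in Ioo (-Real.pi) Real.pi, F (circleMap z ρ θ) := by
    have hper : (fun θ ↦ F (circleMap z ρ θ)).Periodic (2 * Real.pi) :=
      fun x ↦ by simp [periodic_circleMap z ρ x]
    have hs := hper.intervalIntegral_add_eq 0 (-Real.pi)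
    rw [zero_add, show -Real.pi + 2 * Real.pi = Real.pi by ring] at hs
    rw [← hmean, Real.circleAverage_def, hs,
      intervalIntegral.integral_of_le (by linarith [Real.pi_pos]), integral_Ioc_eq_integral_Ioo,
      Complex.real_smul, ← mul_assoc, ← Complex.ofReal_mul,
      mul_inv_cancel₀ (by positivity), Complex.ofReal_one, one_mul]
  calc ENNReal.ofReal (2 * Real.pi) * ‖F z‖ₑ = ‖((2 * Real.pi : ℝ) : ℂ) * F z‖ₑ := by
        rw [enorm_mul, ← ofReal_norm ((2 * Real.pi : ℝ) : ℂ), Complex.norm_real,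
          Real.norm_of_nonneg (by positivity)]
    _ ≤ _ := by rw [hint]; exact enorm_integral_le_lintegral_enorm _

/-- A mean value inequality over disks for holomorphic functions. -/
lemma sq_mul_enorm_le_setLIntegral_ball {F : ℂ → ℂ} {z : ℂ} {r : ℝ} (hr : 0 < r)
    (hF : DifferentiableOn ℂ F (ball z r)) :
    ENNReal.ofReal (r ^ 2) * ‖F z‖ₑ ≤ ∫⁻ ζ in ball z r, ‖F ζ‖ₑ := by
  set G : ℂ → ℝ≥0∞ := (ball z r).indicator fun ζ => ‖F ζ‖ₑ with hG
  have hGm : Measurable G := by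
    classical
    rw [hG, ← Set.piecewise_eq_indicator]
    exact ContinuousOn.measurable_piecewise hF.continuousOn.enorm continuousOn_const
      measurableSet_ball
  have hcirc (ρ θ : ℝ) : z + Complex.polarCoord.symm (ρ, θ) = circleMap z ρ θ := by
    simp [circleMap, Complex.exp_mul_I]
  have e1 : ∫⁻ ζ in ball z r, ‖F ζ‖ₑ = ∫⁻ ζ, G (z + ζ) := by
    rw [lintegral_add_left_eq_self, hG, lintegral_indicator measurableSet_ball]
  have hmeas : Measurable fun q : ℝ × ℝ =>
      ENNReal.ofReal q.1 * G (z + Complex.polarCoord.symm q) := by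
    refine (ENNReal.measurable_ofReal.comp measurable_fst).mul (hGm.comp ?_)
    have : Measurable fun q : ℝ × ℝ => z + ((q.1 : ℂ) * (Real.cos q.2 + Real.sin q.2 * I)) := by
      fun_prop
    simpa only [Complex.polarCoord_symm_apply] using this
  rw [e1, ← Complex.lintegral_comp_polarCoord_symm]
  have hsub : Ioo (r / 2) r ×ˢ Ioo (-Real.pi) Real.pi ⊆ polarCoord.target := by
    rintro ⟨a, b⟩ ⟨h1, h2⟩
    exact ⟨(half_pos hr).trans h1.1, h2⟩
  refine le_trans ?_ (lintegral_mono_set hsub)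
  simp only [smul_eq_mul]
  rw [Measure.volume_eq_prod, setLIntegral_prod _ hmeas.aemeasurable]
  have hbound : ∀ ρ ∈ Ioo (r / 2) r, ENNReal.ofReal (r / 2) * (ENNReal.ofReal (2 * Real.pi) * ‖F z‖ₑ)
      ≤ ∫⁻ θ in Ioo (-Real.pi) Real.pi,
        ENNReal.ofReal ρ * G (z + Complex.polarCoord.symm (ρ, θ)) := by
    intro ρ hρ
    have hρ0 : 0 < ρ := (half_pos hr).trans hρ.1
    rw [lintegral_const_mul' _ _ ENNReal.ofReal_ne_top]
    refine mul_le_mul' (ENNReal.ofReal_le_ofReal hρ.1.le) ?_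
    refine (two_pi_mul_enorm_le_lintegral_circle hρ0.le
      (hF.mono (closedBall_subset_ball hρ.2))).trans_eq ?_
    refine lintegral_congr fun θ => ?_
    rw [hcirc, hG, indicator_of_mem]
    exact sphere_subset_closedBall.trans (closedBall_subset_ball hρ.2)
      (circleMap_mem_sphere z hρ0.le θ)
  refine le_trans ?_ (setLIntegral_mono' measurableSet_Ioo hbound)
  rw [setLIntegral_const, Real.volume_Ioo, ← mul_assoc, mul_right_comm,
    ← ENNReal.ofReal_mul (by positivity), ← ENNReal.ofReal_mul (by positivity)]
  refine mul_le_mul_left (ENNReal.ofReal_le_ofReal ?_) _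
  nlinarith [Real.pi_gt_three, sq_pos_of_pos hr]

/-- Growth estimate in the weighted Bergman space `A_α^1`. -/
lemma enorm_le_of_bergman {F : ℂ → ℂ} (hF : DifferentiableOn ℂ F (ball 0 1)) (α : ℝ) {z : ℂ}
    (hz : ‖z‖ < 1) :
    ENNReal.ofReal (((1 - ‖z‖ ^ 2) / 4) ^ (2 + |α|)) * ‖F z‖ₑ ≤
      ∫⁻ ζ in ball (0 : ℂ) 1, ‖F ζ‖ₑ * ENNReal.ofReal ((1 - ‖ζ‖ ^ 2) ^ α) := by
  set s : ℝ := (1 - ‖z‖ ^ 2) / 4 with hs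
  have hn := norm_nonneg z
  have hs0 : 0 < s := by rw [hs]; nlinarith
  have hs1 : 2 * s ≤ 1 - ‖z‖ := by rw [hs]; nlinarith
  have hlt : ∀ ζ ∈ ball z s, ‖ζ‖ ≤ 1 - s := by
    intro ζ hζ
    have h1 : ‖ζ - z‖ < s := by simpa [dist_eq_norm] using hζ
    have h2 := norm_add_le (ζ - z) z
    rw [sub_add_cancel] at h2
    linarith
  have hsub : ball z s ⊆ ball (0 : ℂ) 1 := fun ζ hζ => by
    simpa using (hlt ζ hζ).trans_lt (by linarith)
  refine le_trans ?_ (lintegral_mono_set hsub)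
  have hw : ∀ ζ ∈ ball z s, ‖F ζ‖ₑ * ENNReal.ofReal (s ^ |α|) ≤
      ‖F ζ‖ₑ * ENNReal.ofReal ((1 - ‖ζ‖ ^ 2) ^ α) := by
    intro ζ hζ
    have h1 := hlt ζ hζ
    have h0 := norm_nonneg ζ
    have h2 : s ≤ 1 - ‖ζ‖ ^ 2 := by nlinarith
    refine mul_le_mul_right (ENNReal.ofReal_le_ofReal ?_) _
    calc s ^ |α| ≤ (1 - ‖ζ‖ ^ 2) ^ |α| := Real.rpow_le_rpow hs0.le h2 (abs_nonneg α)
      _ ≤ (1 - ‖ζ‖ ^ 2) ^ α :=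
        Real.rpow_le_rpow_of_exponent_ge (by linarith) (by nlinarith) (le_abs_self α)
  refine le_trans ?_ (setLIntegral_mono' measurableSet_ball hw)
  rw [lintegral_mul_const' _ _ ENNReal.ofReal_ne_top, Real.rpow_add hs0,
    ENNReal.ofReal_mul (by positivity), Real.rpow_ofNat, mul_right_comm]
  exact mul_le_mul_left (sq_mul_enorm_le_setLIntegral_ball hs0 (hF.mono hsub)) _

open Filter Topology in
/-- An injective holomorphic function on an open set has a holomorphic inverse. -/
lemma exists_holomorphic_inverse {f : ℂ → ℂ} {U : Set ℂ} (hU : IsOpen U)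
    (hf : DifferentiableOn ℂ f U) (hinj : InjOn f U) :
    ∃ g : ℂ → ℂ, DifferentiableOn ℂ g (f '' U) ∧ MapsTo g (f '' U) U ∧
      ∀ w ∈ f '' U, f (g w) = w := by
  classical
  set g := Function.invFunOn f U with hg
  have hmaps : MapsTo g (f '' U) U := fun w hw => Function.invFunOn_mem hw
  have hright : ∀ w ∈ f '' U, f (g w) = w := fun w hw => Function.invFunOn_eq hw
  have hleft : ∀ z ∈ U, g (f z) = z := fun z hz =>
    hinj (hmaps (mem_image_of_mem f hz)) hz (hright _ (mem_image_of_mem f hz))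
  have han : ∀ z ∈ U, AnalyticAt ℂ f z := fun z hz => hf.analyticAt (hU.mem_nhds hz)
  have hnonconst : ∀ z ∈ U, ¬ ∀ᶠ x in 𝓝 z, f x = f z := by
    intro z hz hc
    have h1 : ∀ᶠ x in 𝓝[≠] z, f x = f z ∧ x ∈ U :=
      (hc.and (hU.mem_nhds hz)).filter_mono nhdsWithin_le_nhds
    obtain ⟨x, hx, hne⟩ := (h1.and self_mem_nhdsWithin).exists
    exact hne (hinj hx.2 hz hx.1)
  have hmap : ∀ z ∈ U, 𝓝 (f z) ≤ map f (𝓝 z) := fun z hz =>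
    ((han z hz).eventually_constant_or_nhds_le_map_nhds_aux).resolve_left (hnonconst z hz)
  have hopen : ∀ w ∈ f '' U, f '' U ∈ 𝓝 w := by
    rintro _ ⟨z, hz, rfl⟩
    exact hmap z hz (image_mem_map (hU.mem_nhds hz))
  have hcont : ∀ w ∈ f '' U, ContinuousAt g w := by
    rintro _ ⟨z, hz, rfl⟩
    rw [ContinuousAt, hleft z hz]
    have h1 : Tendsto g (map f (𝓝 z)) (𝓝 z) := by
      rw [tendsto_map'_iff]
      refine tendsto_id.congr' ?_
      filter_upwards [hU.mem_nhds hz] with x hx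
      exact (hleft x hx).symm
    exact h1.mono_left (hmap z hz)
  refine ⟨g, ?_, hmaps, hright⟩
  rintro _ ⟨z, hz, rfl⟩
  have hw : f z ∈ f '' U := mem_image_of_mem f hz
  have hderiv : ∀ᶠ x in 𝓝[≠] z, deriv f x ≠ 0 := by
    refine ((han z hz).deriv.eventually_eq_zero_or_eventually_ne_zero).resolve_left fun h0 => ?_
    obtain ⟨ε, hε, hball⟩ := Metric.eventually_nhds_iff_ball.1 (h0.and (hU.mem_nhds hz))
    refine hnonconst z hz ?_
    filter_upwards [ball_mem_nhds z hε] with x hx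
    exact isOpen_ball.is_const_of_deriv_eq_zero (convex_ball z ε).isPreconnected
      (hf.mono fun y hy => (hball y hy).2) (fun y hy => (hball y hy).1) hx (mem_ball_self hε)
  have hpunct : ∀ᶠ w in 𝓝[≠] (f z), DifferentiableAt ℂ g w := by
    have ht : Tendsto g (𝓝[≠] (f z)) (𝓝[≠] z) := by
      refine tendsto_nhdsWithin_iff.2 ⟨?_, ?_⟩
      · have := hcont _ hw
        rw [ContinuousAt, hleft z hz] at this
        exact this.mono_left nhdsWithin_le_nhds
      · filter_upwards [self_mem_nhdsWithin, mem_nhdsWithin_of_mem_nhds (hopen _ hw)] with w hne hwU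
        rintro (h : g w = z)
        exact hne (by rw [mem_singleton_iff, ← h, hright w hwU])
    filter_upwards [ht.eventually hderiv, mem_nhdsWithin_of_mem_nhds (hopen _ hw)] with w hd hwU
    refine (HasDerivAt.of_local_left_inverse (hcont w hwU)
      (han _ (hmaps hwU)).differentiableAt.hasDerivAt hd ?_).differentiableAt
    filter_upwards [hopen w hwU] with y hy using hright y hy
  exact (analyticAt_of_differentiable_on_punctured_nhds_of_continuousAt hpunct
    (hcont _ hw)).differentiableAt.differentiableWithinAt

open scoped ComplexConjugate in
/-- The identity behind the invariance of the pseudo-hyperbolic distance. -/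
lemma norm_one_sub_conj_mul_sq_sub (a b : ℂ) :
    ‖1 - conj a * b‖ ^ 2 - ‖b - a‖ ^ 2 = (1 - ‖a‖ ^ 2) * (1 - ‖b‖ ^ 2) := by
  simp only [Complex.sq_norm, Complex.normSq_apply]
  simp
  ring

open scoped ComplexConjugate in
/-- A Harnack-type consequence of the Schwarz–Pick lemma. -/
lemma one_sub_norm_sq_le_of_mapsTo_ball {g : ℂ → ℂ} {w w' : ℂ} {ρ : ℝ}
    (hg : DifferentiableOn ℂ g (ball w ρ)) (hmaps : MapsTo g (ball w ρ) (ball 0 1))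
    (hρ : 0 < ρ) (hw' : dist w' w ≤ ρ / 2) :
    3 / 16 * (1 - ‖g w‖ ^ 2) ≤ 1 - ‖g w'‖ ^ 2 := by
  set a := g w with ha
  have hmem : ∀ x ∈ ball w ρ, ‖g x‖ < 1 := fun x hx => by simpa using hmaps hx
  have ha1 : ‖a‖ < 1 := hmem w (mem_ball_self hρ)
  have ha0 := norm_nonneg a
  have hlow : ∀ x ∈ ball w ρ, 1 - ‖a‖ ≤ ‖1 - conj a * g x‖ := by
    intro x hx
    have h1 := norm_sub_norm_le (1 : ℂ) (conj a * g x)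
    rw [norm_one, norm_mul, RCLike.norm_conj] at h1
    nlinarith [hmem x hx, norm_nonneg (g x)]
  have hne : ∀ x ∈ ball w ρ, 1 - conj a * g x ≠ 0 := fun x hx h0 => by
    have := hlow x hx
    rw [h0, norm_zero] at this
    linarith
  have hsq : 0 < 1 - ‖a‖ ^ 2 := by nlinarith
  set G : ℂ → ℂ := fun x => (g x - a) / (1 - conj a * g x) with hG
  have hGd : DifferentiableOn ℂ G (ball w ρ) :=
    (hg.sub_const a).div ((hg.const_mul (conj a)).const_sub 1) hne
  have hGw : G w = 0 := by simp [hG, ha]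
  have hGm : MapsTo G (ball w ρ) (closedBall (G w) 1) := by
    intro x hx
    rw [hGw, mem_closedBall_zero_iff, hG, norm_div,
      div_le_one (norm_pos_iff.2 (hne x hx))]
    have h1 := norm_one_sub_conj_mul_sq_sub a (g x)
    refine abs_le_of_sq_le_sq' ?_ (norm_nonneg _) |>.2
    nlinarith [mul_nonneg hsq.le (by nlinarith [hmem x hx, norm_nonneg (g x)] :
      0 ≤ 1 - ‖g x‖ ^ 2)]
  have hx : w' ∈ ball w ρ := mem_ball.2 (by linarith)
  have hS := Complex.dist_le_div_mul_dist_of_mapsTo_ball hGd hGm hx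
  rw [hGw, dist_zero_right, hG, norm_div, div_le_iff₀ (norm_pos_iff.2 (hne w' hx))] at hS
  have h2 : 1 / ρ * dist w' w ≤ 1 / 2 := by
    rw [div_mul_eq_mul_div, one_mul, div_le_iff₀ hρ]
    linarith
  have h3 : ‖g w' - a‖ ≤ 1 / 2 * ‖1 - conj a * g w'‖ :=
    hS.trans (mul_le_mul_of_nonneg_right h2 (norm_nonneg _))
  have h4 := norm_one_sub_conj_mul_sq_sub a (g w')
  have h5 := hlow w' hx
  have h6 : (1 - ‖a‖ ^ 2) / 2 ≤ ‖1 - conj a * g w'‖ := by nlinarith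
  have h7 : ((1 - ‖a‖ ^ 2) / 2) ^ 2 ≤ ‖1 - conj a * g w'‖ ^ 2 := by gcongr
  have h8 : ‖g w' - a‖ ^ 2 ≤ (1 / 2 * ‖1 - conj a * g w'‖) ^ 2 := by gcongr
  refine le_of_mul_le_mul_left ?_ hsq
  nlinarith

/-- Sectors contain, around each of their directions, balls of radius proportional to the
distance to the vertex. -/
lemma exists_ball_subset_sector {a b φ : ℝ} (hab : φ ∈ Ioo a b) (hπ : φ ∈ Ioo (-Real.pi) Real.pi) :
    ∃ ε > 0, ∀ t : ℝ, 0 < t → ball ((t : ℂ) * Complex.exp (φ * I)) (ε * t) ⊆ sector a b := by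
  set u := Complex.exp (φ * I) with hu
  have harg : u.arg = φ := by
    rw [hu, Complex.exp_mul_I]
    exact Complex.arg_cos_add_sin_mul_I ⟨hπ.1, hπ.2.le⟩
  have hu0 : u ≠ 0 := Complex.exp_ne_zero _
  have hslit : u ∈ slitPlane := mem_slitPlane_iff_arg.2 ⟨by rw [harg]; exact hπ.2.ne, hu0⟩
  have hnhds : sector a b ∈ nhds u := by
    have h1 := (Complex.continuousAt_arg hslit).preimage_mem_nhds
      (Ioo_mem_nhds (harg ▸ hab.1) (harg ▸ hab.2))
    filter_upwards [h1, isOpen_ne.mem_nhds hu0] with x hx hx0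
    exact ⟨hx0, hx.1, hx.2⟩
  obtain ⟨ε, hε, hball⟩ := Metric.mem_nhds_iff.1 hnhds
  refine ⟨ε, hε, fun t ht x hx => ?_⟩
  have htc : (t : ℂ) ≠ 0 := by exact_mod_cast ht.ne'
  have hmem : x / t ∈ ball u ε := by
    rw [mem_ball, dist_eq_norm] at hx ⊢
    rw [show x / t - u = (x - t * u) / t by field_simp, norm_div, Complex.norm_real,
      Real.norm_of_nonneg ht.le, div_lt_iff₀ ht]
    exact hx
  obtain ⟨h0, h1, h2⟩ := hball hmem
  have hx' : x = t * (x / t) := by field_simp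
  have hxarg : x.arg = (x / t).arg := by
    conv_lhs => rw [hx', Complex.arg_real_mul _ ht]
  exact ⟨fun h => h0 (by rw [h, zero_div]), hxarg ▸ h1, hxarg ▸ h2⟩

/-- If two opposite-sided sectors have total opening larger than `π`, one of their directions
lies in the open half-plane `Re (lam * w) > 0`. -/
lemma exists_direction {lam : ℂ} (hlam : lam ≠ 0) {θ₁ θ₂ : ℝ} (h₁ : θ₁ ∈ Ioc 0 Real.pi)
    (h₂ : θ₂ ∈ Ioc 0 Real.pi) (hsum : Real.pi < θ₁ + θ₂) :
    ∃ φ : ℝ, (φ ∈ Ioo (-θ₁) 0 ∨ φ ∈ Ioo 0 θ₂) ∧ 0 < (lam * Complex.exp (φ * I)).re := by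
  have hre (φ : ℝ) : (lam * Complex.exp (φ * I)).re =
      lam.re * Real.cos φ - lam.im * Real.sin φ := by
    rw [Complex.mul_re, Complex.exp_ofReal_mul_I_re, Complex.exp_ofReal_mul_I_im]
  simp only [hre]
  by_contra! hcon
  obtain ⟨h10, h1π⟩ := h₁
  obtain ⟨h20, h2π⟩ := h₂
  set δ := (θ₁ + θ₂ - Real.pi) / 3 with hδ
  have hδ0 : 0 < δ := by rw [hδ]; linarith
  have hzero : ∀ c ∈ Ioo (-θ₁) (θ₂ - Real.pi), lam.re * Real.cos c - lam.im * Real.sin c = 0 := by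
    intro c hc
    have e1 := hcon c (Or.inl ⟨hc.1, by linarith [hc.2]⟩)
    have e2 := hcon (c + Real.pi) (Or.inr ⟨by linarith [hc.1], by linarith [hc.2]⟩)
    rw [Real.cos_add_pi, Real.sin_add_pi] at e2
    linarith
  have ea := hzero (-θ₁ + δ) ⟨by linarith, by linarith⟩
  have eb := hzero (-θ₁ + δ + δ) ⟨by linarith, by linarith⟩
  generalize -θ₁ + δ = c at ea eb
  have hsin : Real.sin δ ≠ 0 := (Real.sin_pos_of_pos_of_lt_pi hδ0 (by linarith)).ne'
  rw [Real.cos_add, Real.sin_add] at eb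
  have k : lam.re * Real.sin c + lam.im * Real.cos c = 0 := by
    have : (lam.re * Real.sin c + lam.im * Real.cos c) * Real.sin δ = 0 := by
      linear_combination Real.cos δ * ea - eb
    exact (mul_eq_zero.1 this).resolve_right hsin
  have hcs := Real.sin_sq_add_cos_sq c
  refine hlam (Complex.ext ?_ ?_)
  · simp only [Complex.zero_re]
    linear_combination Real.cos c * ea + Real.sin c * k - lam.re * hcs
  · simp only [Complex.zero_im]
    linear_combination -Real.sin c * ea + Real.cos c * k - lam.im * hcs

/-- A domain whose inner arguments add up to more than `π` contains cones about a half-line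
along which `Re (lam * w)` grows linearly. -/
lemma exists_cone_subset {Ω : Set ℂ} (hsum : Real.pi < lowerInnerArg Ω + upperInnerArg Ω)
    {lam : ℂ} (hlam : lam ≠ 0) :
    ∃ q u : ℂ, ∃ ε > 0, ‖u‖ = 1 ∧ 0 < (lam * u).re ∧
      ∀ t : ℝ, 0 < t → ball (q + t * u) (ε * t) ⊆ Ω := by
  set A : Set ℝ := {θ : ℝ | θ ∈ Ioc 0 Real.pi ∧
    ∃ q : ℂ, (fun w => q + w) '' sector (-θ) 0 ⊆ Ω ∩ sector (-Real.pi) 0} with hA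
  set B : Set ℝ := {θ : ℝ | θ ∈ Ioc 0 Real.pi ∧
    ∃ q : ℂ, (fun w => q + w) '' sector 0 θ ⊆ Ω ∩ sector 0 Real.pi} with hB
  have hlow : lowerInnerArg Ω = sSup ({0} ∪ A) := rfl
  have hup : upperInnerArg Ω = sSup ({0} ∪ B) := rfl
  have hle {C : Set ℝ} (hC : ∀ θ ∈ C, θ ∈ Ioc 0 Real.pi) : sSup ({0} ∪ C) ≤ Real.pi := by
    refine csSup_le ⟨0, Or.inl rfl⟩ ?_
    rintro x (rfl | hx)
    · exact Real.pi_pos.le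
    · exact (hC x hx).2
  have hex {C : Set ℝ} {x : ℝ} (hx0 : 0 ≤ x) (hx : x < sSup ({0} ∪ C)) : ∃ θ ∈ C, x < θ := by
    obtain ⟨θ, h | h, hlt⟩ :=
      exists_lt_of_lt_csSup (s := {0} ∪ C) ⟨0, Or.inl rfl⟩ hx
    · rw [mem_singleton_iff] at h
      linarith
    · exact ⟨θ, h, hlt⟩
  have hA' := hle (C := A) fun θ h => h.1
  have hB' := hle (C := B) fun θ h => h.1
  rw [hlow, hup] at hsum
  obtain ⟨θ₁, hθ₁, hlt₁⟩ := hex (C := A) (x := Real.pi - sSup ({0} ∪ B)) (by linarith)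
    (by linarith)
  obtain ⟨θ₂, hθ₂, hlt₂⟩ := hex (C := B) (x := Real.pi - θ₁) (by linarith [hθ₁.1.2])
    (by linarith)
  obtain ⟨φ, hφ, hpos⟩ := exists_direction hlam hθ₁.1 hθ₂.1 (by linarith)
  obtain ⟨h₁, q₁, hq₁⟩ := hθ₁
  obtain ⟨h₂, q₂, hq₂⟩ := hθ₂
  have hcone {a b : ℝ} {q : ℂ} (hS : (fun w => q + w) '' sector a b ⊆ Ω) (hab : φ ∈ Ioo a b)
      (hπ : φ ∈ Ioo (-Real.pi) Real.pi) :
      ∃ q u : ℂ, ∃ ε > 0, ‖u‖ = 1 ∧ 0 < (lam * u).re ∧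
        ∀ t : ℝ, 0 < t → ball (q + t * u) (ε * t) ⊆ Ω := by
    obtain ⟨ε, hε, hball⟩ := exists_ball_subset_sector hab hπ
    refine ⟨q, Complex.exp (φ * I), ε, hε,
      Complex.norm_exp_ofReal_mul_I φ, hpos, fun t ht x hx => hS ⟨x - q, hball t ht ?_, by simp⟩⟩
    rw [mem_ball, dist_eq_norm] at hx ⊢
    rwa [sub_sub]
  rcases hφ with hφ | hφ
  · exact hcone (hq₁.trans inter_subset_left) hφ
      ⟨by linarith [hφ.1, h₁.2], by linarith [hφ.2, Real.pi_pos]⟩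
  · exact hcone (hq₂.trans inter_subset_left) hφ
      ⟨by linarith [hφ.1, Real.pi_pos], by linarith [hφ.2, h₂.2]⟩

open Filter Topology in
/-- A sequence growing geometrically is not bounded by an affine function of the index. -/
lemma exists_affine_lt_mul_pow {b r : ℝ} (hb : 0 < b) (hr : 1 < r) (c d : ℝ) :
    ∃ n : ℕ, c + d * n < b * r ^ n := by
  have h0 : Tendsto (fun n : ℕ => (n : ℝ) ^ 0 / r ^ n) atTop (𝓝 0) :=
    tendsto_pow_const_div_const_pow_of_one_lt 0 hr
  have h1 : Tendsto (fun n : ℕ => (n : ℝ) ^ 1 / r ^ n) atTop (𝓝 0) :=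
    tendsto_pow_const_div_const_pow_of_one_lt 1 hr
  have h2 := (h0.const_mul c).add (h1.const_mul d)
  rw [mul_zero, mul_zero, add_zero] at h2
  obtain ⟨n, hn⟩ := (h2.eventually (gt_mem_nhds hb)).exists
  refine ⟨n, ?_⟩
  have hp : 0 < r ^ n := pow_pos (zero_lt_one.trans hr) n
  rw [← mul_div_assoc, ← mul_div_assoc, ← add_div, div_lt_iff₀ hp] at hn
  simpa using hn

/-- The defect `1 - |g|²` of a holomorphic map into the disk decays at most geometrically along a
geometric sequence of points on the axis of a cone. -/
lemma pow_mul_le_one_sub_norm_sq {g : ℂ → ℂ} {Ω : Set ℂ} (hg : DifferentiableOn ℂ g Ω)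
    (hmaps : MapsTo g Ω (ball 0 1)) {q u : ℂ} {ε : ℝ} (hε : 0 < ε) (hu : ‖u‖ = 1)
    (hcone : ∀ t : ℝ, 0 < t → ball (q + t * u) (ε * t) ⊆ Ω) (n : ℕ) :
    (3 / 16) ^ n * (1 - ‖g (q + u)‖ ^ 2) ≤
      1 - ‖g (q + ((1 + ε / 2) ^ n : ℝ) * u)‖ ^ 2 := by
  induction n with
  | zero => simp
  | succ n ih =>
    have ht : 0 < (1 + ε / 2) ^ n := by positivity
    have hsub := hcone _ ht
    have hd : dist (q + ((1 + ε / 2) ^ (n + 1) : ℝ) * u) (q + ((1 + ε / 2) ^ n : ℝ) * u) ≤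
        ε * (1 + ε / 2) ^ n / 2 := by
      rw [dist_add_left, dist_eq_norm, ← sub_mul, norm_mul, hu, mul_one, ← Complex.ofReal_sub,
        Complex.norm_real, show (1 + ε / 2) ^ (n + 1) - (1 + ε / 2) ^ n =
          ε * (1 + ε / 2) ^ n / 2 by ring, Real.norm_of_nonneg (by positivity)]
    have hstep := one_sub_norm_sq_le_of_mapsTo_ball (hg.mono hsub) (hmaps.mono_left hsub)
      (by positivity) hd
    calc (3 / 16) ^ (n + 1) * (1 - ‖g (q + u)‖ ^ 2)
        = 3 / 16 * ((3 / 16) ^ n * (1 - ‖g (q + u)‖ ^ 2)) := by ring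
      _ ≤ _ := (mul_le_mul_of_nonneg_left ih (by norm_num)).trans hstep

lemma nnnorm_exp_rpow_eq_enorm_exp_mul (p : ℝ) (w : ℂ) :
    (‖Complex.exp w‖₊ : ℝ≥0∞) ^ p = ‖Complex.exp (p * w)‖ₑ := by
  rw [← enorm_eq_nnnorm, ← ofReal_norm, ← ofReal_norm,
    ENNReal.ofReal_rpow_of_pos (by simp), Complex.norm_exp, Complex.norm_exp, ← Real.exp_mul]
  simp [mul_comm]

/-- If the image of a Koenigs map contains cones about a half-line on which `Re (lam * w)` grows
linearly, then `exp (lam * h)` belongs to no weighted Bergman space. -/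
lemma not_memBergman_exp_of_cone {Ω : Set ℂ} {h : ℂ → ℂ} (hKoenigs : IsKoenigsMap h Ω)
    {p : ℝ} (hp : 0 < p) (α : ℝ) {lam q u : ℂ} {ε : ℝ} (hε : 0 < ε) (hu : ‖u‖ = 1)
    (hpos : 0 < (lam * u).re) (hcone : ∀ t : ℝ, 0 < t → ball (q + t * u) (ε * t) ⊆ Ω) :
    ¬ MemBergman p α (fun z => Complex.exp (lam * h z)) := by
  obtain ⟨hd, hinj, himg⟩ := hKoenigs
  obtain ⟨g, hg, hmaps, hright⟩ := exists_holomorphic_inverse isOpen_ball hd hinj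
  rw [himg] at hg hmaps hright
  intro hmem
  set F : ℂ → ℂ := fun z => Complex.exp (p * (lam * h z)) with hF
  have hFd : DifferentiableOn ℂ F (ball 0 1) := ((hd.const_mul lam).const_mul (p : ℂ)).cexp
  set J := ∫⁻ ζ in ball (0 : ℂ) 1, ‖F ζ‖ₑ * ENNReal.ofReal ((1 - ‖ζ‖ ^ 2) ^ α) with hJ
  have hJtop : J < ⊤ := by
    simpa only [MemBergman, nnnorm_exp_rpow_eq_enorm_exp_mul] using hmem
  have hΩ (t : ℝ) (ht : 0 < t) : q + t * u ∈ Ω :=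
    hcone t ht (mem_ball_self (by positivity))
  set M : ℝ := 2 + |α| with hM
  have hM0 : 0 ≤ M := by positivity
  set s₀ : ℝ := (1 - ‖g (q + u)‖ ^ 2) / 4 with hs₀
  have hs₀pos : 0 < s₀ := by
    have h1 : ‖g (q + u)‖ < 1 := by simpa using hmaps (by simpa using hΩ 1 one_pos)
    rw [hs₀]
    nlinarith [norm_nonneg (g (q + u))]
  have hbound (n : ℕ) : p * (lam * q).re + p * (lam * u).re * (1 + ε / 2) ^ n +
      M * (n * Real.log (3 / 16) + Real.log s₀) ≤ J.toReal := by
    have ht : 0 < (1 + ε / 2) ^ n := by positivity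
    set w : ℂ := q + ((1 + ε / 2) ^ n : ℝ) * u with hw
    have hwΩ : w ∈ Ω := hΩ _ ht
    have h1 := enorm_le_of_bergman hFd α (z := g w) (by simpa using hmaps hwΩ)
    have h2 := pow_mul_le_one_sub_norm_sq hg hmaps hε hu hcone n
    have h3 : (3 / 16) ^ n * s₀ ≤ (1 - ‖g w‖ ^ 2) / 4 := by
      rw [hs₀]
      linarith
    have h4 : 0 < (3 / 16 : ℝ) ^ n * s₀ := by positivity
    have h5 : ((3 / 16) ^ n * s₀) ^ M ≤ ((1 - ‖g w‖ ^ 2) / 4) ^ M :=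
      Real.rpow_le_rpow h4.le h3 hM0
    have h6 : ‖F (g w)‖ = Real.exp (p * (lam * q).re + p * (lam * u).re * (1 + ε / 2) ^ n) := by
      rw [hF, Complex.norm_exp, hright w hwΩ, Complex.re_ofReal_mul, hw, mul_add, Complex.add_re,
        mul_left_comm, Complex.re_ofReal_mul]
      ring_nf
    have h7 : ((3 / 16) ^ n * s₀) ^ M =
        Real.exp (M * (n * Real.log (3 / 16) + Real.log s₀)) := by
      rw [Real.rpow_def_of_pos h4, Real.log_mul (by positivity) hs₀pos.ne', Real.log_pow, mul_comm]
    rw [← ofReal_norm, ← ENNReal.ofReal_mul (Real.rpow_nonneg (h4.le.trans h3) _),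
      ENNReal.ofReal_le_iff_le_toReal hJtop.ne] at h1
    have h8 : Real.exp (p * (lam * q).re + p * (lam * u).re * (1 + ε / 2) ^ n +
        M * (n * Real.log (3 / 16) + Real.log s₀)) ≤ J.toReal := by
      rw [Real.exp_add, ← h7, ← h6, mul_comm]
      exact (mul_le_mul_of_nonneg_right h5 (norm_nonneg _)).trans h1
    linarith [Real.add_one_le_exp (p * (lam * q).re + p * (lam * u).re * (1 + ε / 2) ^ n +
      M * (n * Real.log (3 / 16) + Real.log s₀))]
  obtain ⟨n, hn⟩ := exists_affine_lt_mul_pow (mul_pos hp hpos) (show 1 < 1 + ε / 2 by linarith)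
    (J.toReal - p * (lam * q).re - M * Real.log s₀) (-(M * Real.log (3 / 16)))
  linarith [hbound n]

/-- **Theorem 1.6(d), Bergman case.** For a parabolic semigroup of zero hyperbolic step with
Koenigs domain `Ω ⊆ ℂ∖(-∞,0]`, if `θ_Ω = θ_Ω⁻ + θ_Ω⁺ ∈ (π, 2π]` then the point spectrum on
`A_α^p` is exactly `{0}`. -/
theorem bergman_spectrum_zhs_large_innerArg
    (Ω : Set ℂ) (hopen : IsOpen Ω) (hsc : SimplyConnectedSpace ↥Ω)
    (hslit : Ω ⊆ {w : ℂ | 0 < w.re ∨ w.im ≠ 0})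
    (hconv : ConvexPosDir Ω)
    (hnohalf : ∀ c : ℝ, ¬ Ω ⊆ {w : ℂ | w.im < c} ∧ ¬ Ω ⊆ {w : ℂ | c < w.im})
    (h : ℂ → ℂ) (hKoenigs : IsKoenigsMap h Ω)
    (p α : ℝ) (hp : 1 ≤ p) (hα : -1 < α)
    (hsum_gt : Real.pi < lowerInnerArg Ω + upperInnerArg Ω)
    (hsum_le : lowerInnerArg Ω + upperInnerArg Ω ≤ 2 * Real.pi)
    (lam : ℂ) :
    MemBergman p α (fun z => Complex.exp (lam * h z)) ↔ lam = 0 := by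
  constructor
  · intro hmem
    by_contra hlam
    obtain ⟨q, u, ε, hε, hu, hpos, hcone⟩ := exists_cone_subset hsum_gt hlam
    exact not_memBergman_exp_of_cone hKoenigs (zero_lt_one.trans_le hp) α hε hu hpos hcone hmem
  · rintro rfl
    simpa [MemBergman] using lintegral_one_sub_normSq_rpow_lt_top hα
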